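/- Let G = ℤ/gℤ, a, b coprime positive integers, and U ⊆ G with 0 ∈ U, not contained in any proper subgroup of G. Then |aU + bU| = |U| if and only if there exist integers a₁ | gcd(g,a) and b₁ | gcd(g,b) and subsets V ⊆ a₁G, X ⊆ b₁G with U = V + X + a₁b₁G and |U| = |V|·|X|·|a₁b₁G|. -/

import Mathlib

/-- The set `a • U + b • V`. -/
def dilateSum {G : Type*} [AddCommGroup G] [DecidableEq G] (a b : ℤ) (U V : Finset G) :
    Finset G :=
  Finset.image₂ (fun x y => a • x + b • y) U V

/-- The stabilizer of a finite set under translation. -/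
def translationStabilizer {G : Type*} [AddCommGroup G] [DecidableEq G] (U : Finset G) :
    AddSubgroup G where
  carrier := {s | ∀ x ∈ U, x + s ∈ U}
  zero_mem' := by simp
  add_mem' := by
    intro s t hs ht x hx
    rw [← add_assoc]
    exact ht _ (hs x hx)
  neg_mem' := by
    intro s hs x hx
    have hsub : U.image (· + s) ⊆ U := by
      intro y hy
      obtain ⟨z, hz, rfl⟩ := Finset.mem_image.1 hy
      exact hs z hz
    have heq : U.image (· + s) = U :=
      Finset.eq_of_subset_of_card_le hsub
        (Finset.card_image_of_injective U (add_left_injective s)).ge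
    rw [← heq] at hx
    obtain ⟨z, hz, rfl⟩ := Finset.mem_image.1 hx
    simpa using hz

section

variable {G : Type*} [AddCommGroup G] [DecidableEq G]

theorem mem_translationStabilizer {U : Finset G} {s : G} :
    s ∈ translationStabilizer U ↔ ∀ x ∈ U, x + s ∈ U :=
  Iff.rfl

theorem mem_dilateSum {a b : ℤ} {U V : Finset G} {t : G} :
    t ∈ dilateSum a b U V ↔ ∃ x ∈ U, ∃ y ∈ V, a • x + b • y = t := by
  simp [dilateSum, Finset.mem_image₂]

theorem mem_of_sub_mem_translationStabilizer {U : Finset G} {x y : G} (hx : x ∈ U)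
    (h : y - x ∈ translationStabilizer U) : y ∈ U := by
  simpa using h x hx

/-- If `|aU + bU| = |U|` and `U` is invariant under `ab(U - U)`, then `U` is a product with respect
to the decomposition into the parts killed by `b` and by `a`. -/
theorem bezout_combination_mem {a b α β : ℤ} (hαβ : α * a + β * b = 1) {U : Finset G}
    (hcard : (dilateSum a b U U).card = U.card)
    (hstab : ∀ w ∈ U, ∀ u ∈ U, (a * b) • (w - u) ∈ translationStabilizer U)
    {x y : G} (hx : x ∈ U) (hy : y ∈ U) : (α * a) • x + (β * b) • y ∈ U := by
  set N := translationStabilizer U with hN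
  let r : G → G := fun u => (QuotientAddGroup.mk u : G ⧸ N).out
  have hr : ∀ u, u - r u ∈ N := by
    intro u
    have h := Quotient.out_eq' (QuotientAddGroup.mk u : G ⧸ N)
    have h2 := QuotientAddGroup.eq.1 h
    rwa [neg_add_eq_sub] at h2
  have hrU : ∀ u ∈ U, r u ∈ U := fun u hu =>
    mem_of_sub_mem_translationStabilizer hu (by simpa using N.neg_mem (hr u))
  have hrep : ∀ u v, r u - r v ∈ N → r u = r v := by
    intro u v h
    have h1 : u - v ∈ N := by
      have := N.add_mem (N.sub_mem (hr u) (hr v)) h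
      convert this using 1
      abel
    have : (QuotientAddGroup.mk v : G ⧸ N) = QuotientAddGroup.mk u :=
      QuotientAddGroup.eq.2 (by rwa [neg_add_eq_sub])
    simp only [r, this]
  let f : G → G := fun u => (a + b) • r u + (u - r u)
  have hfmem : ∀ u ∈ U, f u ∈ dilateSum a b U U := by
    intro u hu
    refine mem_dilateSum.2 ⟨r u + α • (u - r u), N.zsmul_mem (hr u) α _ (hrU u hu),
      r u + β • (u - r u), N.zsmul_mem (hr u) β _ (hrU u hu), ?_⟩
    have : a • (r u + α • (u - r u)) + b • (r u + β • (u - r u))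
        = (a + b) • r u + (α * a + β * b) • (u - r u) := by module
    rw [this, hαβ, one_smul]
  have hfinj : Set.InjOn f U := by
    intro u hu v hv huv
    have huv' : (a + b) • r u + (u - r u) = (a + b) • r v + (v - r v) := huv
    have h1 : (a + b) • (r u - r v) ∈ N := by
      have := N.sub_mem (hr v) (hr u)
      convert this using 1
      linear_combination (norm := module) huv'
    have h2 : r u - r v ∈ N := by
      have h3 := N.add_mem (N.zsmul_mem h1 (α ^ 2 * a + β ^ 2 * b))
        (N.zsmul_mem (hstab _ (hrU u hu) _ (hrU v hv)) (2 * α * β - α ^ 2 - β ^ 2))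
      convert h3 using 1
      have h4 : (1 : ℤ) = (α ^ 2 * a + β ^ 2 * b) * (a + b) +
          (2 * α * β - α ^ 2 - β ^ 2) * (a * b) := by
        linear_combination (-(α * a + β * b) - 1) * hαβ
      rw [smul_smul, smul_smul, ← add_smul, ← h4, one_smul]
    have h3 := hrep u v h2
    rw [h3] at huv'
    simpa using huv'
  have himg : U.image f = dilateSum a b U U := by
    refine Finset.eq_of_subset_of_card_le (Finset.image_subset_iff.2 hfmem) ?_
    rw [hcard, Finset.card_image_of_injOn hfinj]
  have hT : a • x + b • y ∈ U.image f := himg ▸ mem_dilateSum.2 ⟨x, hx, y, hy, rfl⟩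
  obtain ⟨u, hu, huxy⟩ := Finset.mem_image.1 hT
  have huxy' : (a + b) • r u + (u - r u) = a • x + b • y := huxy
  refine mem_of_sub_mem_translationStabilizer (hrU u hu) ?_
  have h1 := N.add_mem (N.add_mem (N.zsmul_mem (hr u) (α ^ 2 * a + β ^ 2 * b))
    (N.zsmul_mem (hstab _ hx _ (hrU u hu)) (α * β - β ^ 2)))
    (N.zsmul_mem (hstab _ hy _ (hrU u hu)) (α * β - α ^ 2))
  convert h1 using 1
  have h2 : u - r u = a • (x - r u) + b • (y - r u) := by
    linear_combination (norm := module) huxy'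
  have h3 : α * a = (α ^ 2 * a + β ^ 2 * b) * a + (α * β - β ^ 2) * (a * b) := by
    linear_combination (- (α * a)) * hαβ
  have h4 : β * b = (α ^ 2 * a + β ^ 2 * b) * b + (α * β - α ^ 2) * (a * b) := by
    linear_combination (- (β * b)) * hαβ
  have h5 : (α * a) • x + (β * b) • y - r u = (α * a) • (x - r u) + (β * b) • (y - r u) := by
    have : r u = (α * a + β * b) • r u := by rw [hαβ, one_smul]
    nth_rewrite 1 [this]
    module
  rw [h5, h2, h3, h4]
  module

theorem zsmul_sub_mem_translationStabilizer_of_subset {a b α β : ℤ} (hαβ : α * a + β * b = 1)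
    {U U₁ : Finset G} (hcard : (dilateSum a b U₁ U₁).card = U₁.card)
    (hstab : ∀ w ∈ U₁, ∀ u ∈ U₁, (a * b) • (w - u) ∈ translationStabilizer U₁)
    (hsub : dilateSum a b U U₁ ⊆ dilateSum a b U₁ U₁)
    {w u : G} (hw : w ∈ U) (hu : u ∈ U₁) :
    (a * b) • (w - u) ∈ translationStabilizer U₁ := by
  set N := translationStabilizer U₁ with hN
  have hex : ∀ x ∈ U₁, ∃ x' ∈ U₁, ∃ x'' ∈ U₁, a • (w - x') = b • (x'' - x) := by
    intro x hx
    obtain ⟨x', hx', x'', hx'', h⟩ := mem_dilateSum.1 (hsub (mem_dilateSum.2 ⟨w, hw, x, hx, rfl⟩))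
    exact ⟨x', hx', x'', hx'', by linear_combination (norm := module) -h⟩
  have h1 : (β ^ 2 * (a * b)) • (w - u) ∈ N := by
    intro x hx
    obtain ⟨x', hx', x'', hx'', h⟩ := hex x hx
    refine mem_of_sub_mem_translationStabilizer
      (bezout_combination_mem hαβ hcard hstab hx hx'') ?_
    have h2 := N.sub_mem (N.zsmul_mem (hstab x' hx' u hu) (β ^ 2))
      (N.zsmul_mem (hstab x'' hx'' x hx) (α * β))
    convert h2 using 1
    have h3 : (β ^ 2 * (a * b)) • (w - u) =
        (β ^ 2 * b) • (b • (x'' - x)) + (β ^ 2 * (a * b)) • (x' - u) := by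
      rw [← h]
      module
    have h4 : (β * b) = β ^ 2 * b * b + (α * β) * (a * b) := by
      linear_combination (- (β * b)) * hαβ
    have h5 : (α * a) • x + (β * b) • x'' = x + (β * b) • (x'' - x) := by
      have : (α * a) = 1 - β * b := by linear_combination hαβ
      rw [this]
      module
    rw [h5, h3, h4]
    module
  have h2 : (a * (a * b)) • (w - u) ∈ N := by
    obtain ⟨x', hx', x'', hx'', h⟩ := hex u hu
    have h3 := N.add_mem (N.zsmul_mem (hstab x'' hx'' u hu) b)
      (N.zsmul_mem (hstab x' hx' u hu) a)
    convert h3 using 1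
    have h4 : (a * (a * b)) • (w - u) = (a * b) • (a • (w - x')) + (a * (a * b)) • (x' - u) := by
      module
    rw [h4, h]
    module
  have h3 := N.add_mem (N.zsmul_mem h1 (b ^ 2)) (N.zsmul_mem h2 (2 * α - α ^ 2 * a))
  convert h3 using 1
  rw [smul_smul, smul_smul, ← add_smul]
  congr 1
  linear_combination (a * b * (α * a - 1 - β * b)) * hαβ

theorem card_le_card_dilateSum_of_injOn {a b : ℤ} {U : Finset G}
    (hinj : Set.InjOn (fun x : G => a • x) U) :
    U.card ≤ (dilateSum a b U U).card ∧ ((dilateSum a b U U).card = U.card →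
      ∀ w ∈ U, ∀ u ∈ U, ∀ x ∈ U, ∃ y ∈ U, a • y = a • x + (a * (a * b)) • (w - u)) := by
  have himg : ∀ u ∈ U, U.image (fun x => a • x + b • u) ⊆ dilateSum a b U U := by
    intro u hu y hy
    obtain ⟨z, hz, rfl⟩ := Finset.mem_image.1 hy
    exact mem_dilateSum.2 ⟨z, hz, u, hu, rfl⟩
  have hc : ∀ u : G, (U.image (fun x => a • x + b • u)).card = U.card := by
    intro u
    refine Finset.card_image_of_injOn fun x hx y hy hxy => hinj hx hy ?_
    simpa using hxy
  constructor
  · rcases U.eq_empty_or_nonempty with rfl | ⟨u, hu⟩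
    · simp
    · exact (hc u).ge.trans (Finset.card_le_card (himg u hu))
  · intro hcard w hw u hu x hx
    have hmem : b • (w - u) ∈ translationStabilizer (U.image (fun x => a • x)) := by
      intro z hz
      obtain ⟨x, hx, rfl⟩ := Finset.mem_image.1 hz
      have heq := Finset.eq_of_subset_of_card_le (himg u hu) (by rw [hcard, hc u])
      have h1 : a • x + b • w ∈ U.image (fun x => a • x + b • u) :=
        heq ▸ mem_dilateSum.2 ⟨x, hx, w, hw, rfl⟩
      obtain ⟨y, hy, h⟩ := Finset.mem_image.1 h1
      refine Finset.mem_image.2 ⟨y, hy, ?_⟩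
      linear_combination (norm := module) h
    have h1 := (translationStabilizer _).zsmul_mem hmem (a * a) _ (Finset.mem_image_of_mem _ hx)
    obtain ⟨y, hy, h⟩ := Finset.mem_image.1 h1
    refine ⟨y, hy, ?_⟩
    rw [h]
    module

/-- For coprime `a` and `b` one has `|U| ≤ |aU + bU|`, and equality forces `U` to be invariant
under translation by `ab(U - U)`. -/
theorem card_le_card_dilateSum [Finite G] {a b α β : ℤ} (hαβ : α * a + β * b = 1)
    (U : Finset G) :
    U.card ≤ (dilateSum a b U U).card ∧ ((dilateSum a b U U).card = U.card →
      ∀ w ∈ U, ∀ u ∈ U, (a * b) • (w - u) ∈ translationStabilizer U) := by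
  induction U using Finset.strongInduction with
  | H U ih =>
  rcases U.eq_empty_or_nonempty with rfl | ⟨u₀, hu₀⟩
  · simp
  let L : AddSubgroup G := AddSubgroup.closure ((fun x => x - u₀) '' (U : Set G))
  let M : AddSubgroup G := L.map (zsmulAddGroupHom a)
  have hUL₀ : ∀ x ∈ U, x - u₀ ∈ L := fun x hx =>
    AddSubgroup.subset_closure ⟨x, hx, rfl⟩
  have hUL : ∀ x ∈ U, ∀ y ∈ U, x - y ∈ L := fun x hx y hy => by
    simpa using L.sub_mem (hUL₀ x hx) (hUL₀ y hy)
  have haM : ∀ l ∈ L, a • l ∈ M := fun l hl => ⟨l, hl, rfl⟩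
  have hML : M ≤ L := by
    rintro _ ⟨l, hl, rfl⟩
    exact L.zsmul_mem hl a
  by_cases hall : ∀ u ∈ U, u - u₀ ∈ M
  · have hLM : L ≤ M := by
      rw [AddSubgroup.closure_le]
      rintro _ ⟨x, hx, rfl⟩
      exact hall x hx
    have hinjL : Function.Injective (fun l : L => a • l) := by
      rw [Finite.injective_iff_surjective]
      rintro ⟨l, hl⟩
      obtain ⟨k, hk, h⟩ := hLM hl
      exact ⟨⟨k, hk⟩, Subtype.ext h⟩
    have hinj : ∀ l ∈ L, a • l = 0 → l = 0 := by
      intro l hl h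
      have : (⟨l, hl⟩ : L) = 0 := hinjL (by
        apply Subtype.ext
        simpa using h)
      simpa using this
    have hinjU : Set.InjOn (fun x : G => a • x) U := by
      intro x hx y hy hxy
      refine sub_eq_zero.1 (hinj _ (hUL x hx y hy) ?_)
      rw [smul_sub]
      exact sub_eq_zero.2 hxy
    obtain ⟨h1, h2⟩ := card_le_card_dilateSum_of_injOn (b := b) hinjU
    refine ⟨h1, fun hcard w hw u hu x hx => ?_⟩
    obtain ⟨y, hy, h⟩ := h2 hcard w hw u hu x hx
    have hyx : y - (x + (a * b) • (w - u)) = 0 := by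
      apply hinj
      · rw [← sub_sub]
        exact L.sub_mem (hUL y hy x hx) (L.zsmul_mem (hUL w hw u hu) _)
      · rw [smul_sub, h]
        module
    rwa [← sub_eq_zero.1 hyx]
  · classical
    push Not at hall
    obtain ⟨v₀, hv₀, hv₀M⟩ := hall
    let U₁ := U.filter (fun x => x - u₀ ∈ M)
    let U₂ := U.filter (fun x => x - u₀ ∉ M)
    have hss₁ : U₁ ⊂ U := Finset.filter_ssubset.2 ⟨v₀, hv₀, hv₀M⟩
    have hss₂ : U₂ ⊂ U := Finset.filter_ssubset.2 ⟨u₀, hu₀, by simp⟩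
    have hcardU : U₁.card + U₂.card = U.card :=
      Finset.card_filter_add_card_filter_not (s := U) (fun x => x - u₀ ∈ M)
    have hdisj : Disjoint (dilateSum a b U U₁) (dilateSum a b U U₂) := by
      rw [Finset.disjoint_left]
      intro t ht₁ ht₂
      obtain ⟨x, hx, y, hy, rfl⟩ := mem_dilateSum.1 ht₁
      obtain ⟨x', hx', y', hy', h⟩ := mem_dilateSum.1 ht₂
      obtain ⟨hyU, hyM⟩ := Finset.mem_filter.1 hy
      obtain ⟨hyU', hyM'⟩ := Finset.mem_filter.1 hy'
      apply hyM'
      have h1 : b • (y' - y) ∈ M := by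
        have := haM _ (hUL x hx x' hx')
        convert this using 1
        linear_combination (norm := module) h
      have h2 : y' - y ∈ M := by
        have := M.add_mem (M.zsmul_mem (haM _ (hUL y' hyU' y hyU)) α) (M.zsmul_mem h1 β)
        rwa [smul_smul, smul_smul, ← add_smul, hαβ, one_smul] at this
      simpa using M.add_mem h2 hyM
    have hunion : dilateSum a b U U = dilateSum a b U U₁ ∪ dilateSum a b U U₂ := by
      rw [dilateSum, dilateSum, dilateSum, ← Finset.image₂_union_right,
        Finset.filter_union_filter_not_eq]
    have hcardT : (dilateSum a b U U).card =
        (dilateSum a b U U₁).card + (dilateSum a b U U₂).card := by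
      rw [hunion, Finset.card_union_of_disjoint hdisj]
    have hsub₁ : dilateSum a b U₁ U₁ ⊆ dilateSum a b U U₁ :=
      Finset.image₂_subset_right hss₁.subset
    have hsub₂ : dilateSum a b U₂ U₂ ⊆ dilateSum a b U U₂ :=
      Finset.image₂_subset_right hss₂.subset
    have hle₁ := Finset.card_le_card hsub₁
    have hle₂ := Finset.card_le_card hsub₂
    obtain ⟨hi₁, he₁⟩ := ih U₁ hss₁
    obtain ⟨hi₂, he₂⟩ := ih U₂ hss₂
    refine ⟨by omega, fun hcard => ?_⟩
    have key : ∀ U' : Finset G, (dilateSum a b U' U').card = U'.card →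
        (∀ w ∈ U', ∀ u ∈ U', (a * b) • (w - u) ∈ translationStabilizer U') →
        dilateSum a b U' U' ⊆ dilateSum a b U U' →
        (dilateSum a b U U').card ≤ (dilateSum a b U' U').card →
        ∀ w ∈ U, ∀ u ∈ U, ∀ x ∈ U', x + (a * b) • (w - u) ∈ U' := by
      intro U' hc hs hsub hle w hw u hu x hx
      have heq := Finset.eq_of_subset_of_card_le hsub hle
      have h1 := zsmul_sub_mem_translationStabilizer_of_subset hαβ hc hs heq.ge hw hx
      have h2 := zsmul_sub_mem_translationStabilizer_of_subset hαβ hc hs heq.ge hu hx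
      have h3 := (translationStabilizer U').sub_mem h1 h2
      rw [← smul_sub, sub_sub_sub_cancel_right] at h3
      exact h3 x hx
    intro w hw u hu x hx
    by_cases hxM : x - u₀ ∈ M
    · exact hss₁.subset (key U₁ (by omega) (he₁ (by omega)) hsub₁ (by omega) w hw u hu x
        (Finset.mem_filter.2 ⟨hx, hxM⟩))
    · exact hss₂.subset (key U₂ (by omega) (he₂ (by omega)) hsub₂ (by omega) w hw u hu x
        (Finset.mem_filter.2 ⟨hx, hxM⟩))

end

theorem exists_intCast_gcd_eq (g a : ℕ) :
    ∃ k : ZMod g, ((Nat.gcd g a : ℕ) : ZMod g) = (a : ZMod g) * k := by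
  refine ⟨((Nat.gcdB g a : ℤ) : ZMod g), ?_⟩
  have h := congrArg (fun z : ℤ => (z : ZMod g)) (Nat.gcd_eq_gcd_ab g a)
  simpa using h

theorem exists_natCast_eq_mul_of_dvd {R : Type*} [CommRing R] {m n : ℕ} (h : m ∣ n) :
    ∃ k : R, (n : R) = (m : R) * k := by
  obtain ⟨k, rfl⟩ := h
  exact ⟨k, by push_cast; rfl⟩

theorem dilateSum_natCast {R : Type*} [CommRing R] [DecidableEq R] (a b : ℕ) (U : Finset R) :
    Finset.image₂ (fun x y => (a : R) * x + (b : R) * y) U U = dilateSum (a : ℤ) (b : ℤ) U U := by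
  simp [dilateSum]

/-- A finite set that is a product modulo the subgroup `H = cR`, with respect to complementary
idempotents `e` and `f` modulo `c`, is a direct sum `V + X + H`. -/
theorem exists_direct_decomposition {R : Type*} [CommRing R] [DecidableEq R] [Fintype R]
    {c e f : R} (hef : e + f = 1) (hc : ∃ k, e * f = c * k) (U : Finset R)
    (hstab : ∀ x ∈ U, ∀ w, x + c * w ∈ U) (hprod : ∀ x ∈ U, ∀ y ∈ U, e * x + f * y ∈ U) :
    ∃ V X : Finset R,
      (∀ v ∈ V, ∃ x w, v = e * x + c * w) ∧ (∀ v ∈ X, ∃ x w, v = f * x + c * w) ∧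
      U = Finset.image₂ (fun v x => v + x) V
        (Finset.image₂ (fun x h => x + h) X (Finset.image (fun w => c * w) Finset.univ)) ∧
      U.card = V.card * X.card * (Finset.image (fun w => c * w) Finset.univ).card := by
  obtain ⟨k, hk⟩ := hc
  let H : AddSubgroup R := (AddMonoidHom.mulLeft c).range
  have hH : ∀ {x}, x ∈ H ↔ ∃ w, c * w = x := Iff.rfl
  let ρ : R → R := fun u => (QuotientAddGroup.mk u : R ⧸ H).out
  have hρ : ∀ u, ∃ w, ρ u = u + c * w := by
    intro u
    have h := Quotient.out_eq' (QuotientAddGroup.mk u : R ⧸ H)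
    obtain ⟨w, hw⟩ := hH.1 (QuotientAddGroup.eq.1 h)
    refine ⟨-w, ?_⟩
    linear_combination hw
  have hρeq : ∀ u v w, u - v = c * w → ρ u = ρ v := by
    intro u v w h
    have : (QuotientAddGroup.mk v : R ⧸ H) = QuotientAddGroup.mk u :=
      QuotientAddGroup.eq.2 (hH.2 ⟨w, by linear_combination -h⟩)
    simp only [ρ, this]
  have hdirect : ∀ x y x' y' w w', ρ (e * x) + (ρ (f * y) + c * w) =
      ρ (e * x') + (ρ (f * y') + c * w') → ρ (e * x) = ρ (e * x') ∧ ρ (f * y) = ρ (f * y') := by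
    intro x y x' y' w w' h
    obtain ⟨w₁, h₁⟩ := hρ (e * x)
    obtain ⟨w₂, h₂⟩ := hρ (f * y)
    obtain ⟨w₃, h₃⟩ := hρ (e * x')
    obtain ⟨w₄, h₄⟩ := hρ (f * y')
    rw [h₁, h₂, h₃, h₄] at h
    have hf : f = 1 - e := by linear_combination hef
    subst hf
    constructor
    · refine hρeq _ _ (k * (x - x') - k * (y - y') - e * (w₁ + w₂ + w - w₃ - w₄ - w')) ?_
      linear_combination e * h + (x - x' - y + y') * hk
    · refine hρeq _ _ (k * (y - y') - k * (x - x') -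
        (1 - e) * (w₁ + w₂ + w - w₃ - w₄ - w')) ?_
      linear_combination (1 - e) * h + (y - y' - x + x') * hk
  have hU : U = Finset.image₂ (fun v x => v + x) (U.image fun x => ρ (e * x))
      (Finset.image₂ (fun x h => x + h) (U.image fun x => ρ (f * x))
        (Finset.image (fun w => c * w) Finset.univ)) := by
    ext u
    simp only [Finset.mem_image₂, Finset.mem_image, Finset.mem_univ, true_and]
    constructor
    · intro hu
      obtain ⟨w₁, h₁⟩ := hρ (e * u)
      obtain ⟨w₂, h₂⟩ := hρ (f * u)
      refine ⟨_, ⟨u, hu, rfl⟩, _, ⟨_, ⟨u, hu, rfl⟩, _, ⟨-w₁ - w₂, rfl⟩, rfl⟩, ?_⟩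
      rw [h₁, h₂]
      linear_combination u * hef
    · rintro ⟨_, ⟨x, hx, rfl⟩, _, ⟨_, ⟨y, hy, rfl⟩, _, ⟨w, rfl⟩, rfl⟩, rfl⟩
      obtain ⟨w₁, h₁⟩ := hρ (e * x)
      obtain ⟨w₂, h₂⟩ := hρ (f * y)
      have h := hstab _ (hprod x hx y hy) (w₁ + w₂ + w)
      convert h using 1
      rw [h₁, h₂]
      ring
  refine ⟨U.image fun x => ρ (e * x), U.image fun x => ρ (f * x), ?_, ?_, hU, ?_⟩
  · intro v hv
    obtain ⟨x, -, rfl⟩ := Finset.mem_image.1 hv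
    obtain ⟨w, hw⟩ := hρ (e * x)
    exact ⟨x, w, hw⟩
  · intro v hv
    obtain ⟨x, -, rfl⟩ := Finset.mem_image.1 hv
    obtain ⟨w, hw⟩ := hρ (f * x)
    exact ⟨x, w, hw⟩
  · conv_lhs => rw [hU]
    rw [mul_assoc, Finset.card_image₂_iff.2, Finset.card_image₂_iff.2]
    · rintro ⟨y, h⟩ hy ⟨y', h'⟩ hy' heq
      simp only [Set.mem_prod, Finset.coe_image, Set.mem_image, Finset.coe_univ, Set.mem_univ,
        true_and] at hy hy'
      obtain ⟨⟨y, -, rfl⟩, w, rfl⟩ := hy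
      obtain ⟨⟨y', -, rfl⟩, w', rfl⟩ := hy'
      have heq' : ρ (f * y) + c * w = ρ (f * y') + c * w' := heq
      have h2 := (hdirect 0 y 0 y' w w' (by rw [heq'])).2
      rw [h2] at heq'
      rw [h2, add_left_cancel heq']
    · rintro ⟨v, s⟩ hv ⟨v', s'⟩ hv' heq
      simp only [Set.mem_prod, Finset.coe_image₂, Finset.coe_image, Set.mem_image, Set.mem_image2,
        Finset.coe_univ, Set.mem_univ, true_and] at hv hv'
      obtain ⟨⟨x, -, rfl⟩, _, ⟨y, -, rfl⟩, _, ⟨w, rfl⟩, rfl⟩ := hv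
      obtain ⟨⟨x', -, rfl⟩, _, ⟨y', -, rfl⟩, _, ⟨w', rfl⟩, rfl⟩ := hv'
      have heq' : ρ (e * x) + (ρ (f * y) + c * w) = ρ (e * x') + (ρ (f * y') + c * w') := heq
      have h2 := (hdirect x y x' y' w w' heq').1
      rw [h2] at heq'
      rw [h2, add_left_cancel heq']

/-- A direct sum `V + X + pqR` with `V ⊆ pR`, `X ⊆ qR`, `p ∣ a` and `q ∣ b` satisfies
`|aU + bU| = |U|`. -/
theorem card_image₂_eq_of_direct_decomposition {R : Type*} [CommRing R] [DecidableEq R] [Fintype R]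
    {a b α β p q : R} (hαβ : α * a + β * b = 1) (hp : ∃ k, a = p * k) (hq : ∃ k, b = q * k)
    {U V X : Finset R} (hV : ∀ v ∈ V, ∃ w, v = p * w) (hX : ∀ x ∈ X, ∃ w, x = q * w)
    (hU : U = Finset.image₂ (fun v x => v + x) V
      (Finset.image₂ (fun x h => x + h) X (Finset.image (fun w => p * q * w) Finset.univ)))
    (hcard : U.card = V.card * X.card * (Finset.image (fun w => p * q * w) Finset.univ).card) :
    (Finset.image₂ (fun x y => a * x + b * y) U U).card = U.card := by
  obtain ⟨k, rfl⟩ := hp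
  obtain ⟨l, rfl⟩ := hq
  set H : Finset R := Finset.image (fun w => p * q * w) Finset.univ with hHdef
  have hH : ∀ {x}, x ∈ H ↔ ∃ w, p * q * w = x := by simp [hHdef]
  have hmem : ∀ {x}, x ∈ U ↔ ∃ t ∈ V ×ˢ X ×ˢ H, t.1 + (t.2.1 + t.2.2) = x := by
    intro x
    rw [hU]
    simp only [Finset.mem_image₂, Finset.mem_product, Prod.exists]
    constructor
    · rintro ⟨v, hv, _, ⟨x, hx, h, hh, rfl⟩, rfl⟩
      exact ⟨v, x, h, ⟨hv, hx, hh⟩, rfl⟩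
    · rintro ⟨v, x, h, ⟨hv, hx, hh⟩, rfl⟩
      exact ⟨v, hv, _, ⟨x, hx, h, hh, rfl⟩, rfl⟩
  have hprod : (V ×ˢ X ×ˢ H).card = U.card := by
    rw [hcard, Finset.card_product, Finset.card_product, mul_assoc]
  have himg : (V ×ˢ X ×ˢ H).image (fun t => t.1 + (t.2.1 + t.2.2)) = U := by
    ext x
    rw [hmem, Finset.mem_image]
  have hinj : Set.InjOn (fun t : R × R × R => t.1 + (t.2.1 + t.2.2)) (V ×ˢ X ×ˢ H : Finset _) := by
    rw [← Finset.card_image_iff, himg, hprod]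
  have himg' : Finset.image₂ (fun x y => p * k * x + q * l * y) U U =
      (V ×ˢ X ×ˢ H).image (fun t => p * k * t.1 + (q * l * t.2.1 + t.2.2)) := by
    ext z
    simp only [Finset.mem_image₂, Finset.mem_image, hmem, Finset.mem_product, Prod.exists]
    constructor
    · rintro ⟨_, ⟨v, x, h, ⟨hv, hx, hh⟩, rfl⟩, _, ⟨v', x', h', ⟨hv', hx', hh'⟩, rfl⟩, rfl⟩
      refine ⟨v, x', p * k * (x + h) + q * l * (v' + h'), ⟨hv, hx', ?_⟩, by ring⟩
      obtain ⟨w, rfl⟩ := hX x hx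
      obtain ⟨w', rfl⟩ := hV v' hv'
      obtain ⟨s, rfl⟩ := hH.1 hh
      obtain ⟨s', rfl⟩ := hH.1 hh'
      exact hH.2 ⟨k * w + k * p * s + l * w' + l * q * s', by ring⟩
    · rintro ⟨v, x, h, ⟨hv, hx, hh⟩, rfl⟩
      obtain ⟨w, hw⟩ := hX x hx
      obtain ⟨w', hw'⟩ := hV v hv
      obtain ⟨s, hs⟩ := hH.1 hh
      refine ⟨_, ⟨v, x, p * q * (α * (s - k * w - l * w')), ⟨hv, hx, hH.2 ⟨_, rfl⟩⟩, rfl⟩,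
        _, ⟨v, x, p * q * (β * (s - k * w - l * w')), ⟨hv, hx, hH.2 ⟨_, rfl⟩⟩, rfl⟩, ?_⟩
      rw [← hs, hw, hw']
      linear_combination (p * q * (s - k * w - l * w')) * hαβ
  rw [himg', Finset.card_image_of_injOn, hprod]
  rintro ⟨v, x, h⟩ ht ⟨v', x', h'⟩ ht' heq
  have ht₀ := ht
  have ht₀' := ht'
  simp only [Finset.coe_product, Set.mem_prod, Finset.mem_coe] at ht₀ ht₀'
  obtain ⟨hv, hx, hh⟩ := ht₀
  obtain ⟨hv', hx', hh'⟩ := ht₀'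
  have heq' : p * k * v + (q * l * x + h) = p * k * v' + (q * l * x' + h') := heq
  obtain ⟨w₁, h₁⟩ := hV v hv
  obtain ⟨w₂, h₂⟩ := hV v' hv'
  obtain ⟨w₃, h₃⟩ := hX x hx
  obtain ⟨w₄, h₄⟩ := hX x' hx'
  obtain ⟨s, hs⟩ := hH.1 hh
  obtain ⟨s', hs'⟩ := hH.1 hh'
  have hdiff : ∃ z, v + x = v' + x' + p * q * z := by
    refine ⟨(α ^ 2 * (p * k) + β ^ 2 * (q * l)) * (s' - s)
      + k * l * (α * β - β ^ 2) * (v - v') + k * l * (α * β - α ^ 2) * (x - x')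
      + β * l * (w₁ - w₂) + α * k * (w₃ - w₄), ?_⟩
    linear_combination (α ^ 2 * (p * k) + β ^ 2 * (q * l)) * (heq' + hs - hs')
      + β * (q * l) * (h₁ - h₂) + α * (p * k) * (h₃ - h₄)
      - ((1 + α * (p * k)) * (v - v') + (1 + β * (q * l)) * (x - x')) * hαβ
  obtain ⟨z, hz⟩ := hdiff
  have h0 := @hinj (v, x, p * q * 0) (by simpa [hv, hx] using hH.2 ⟨0, by ring⟩)
    (v', x', p * q * z) (by simpa [hv', hx'] using hH.2 ⟨z, rfl⟩)
    (by simpa [add_assoc] using hz)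
  simp only [Prod.mk.injEq] at h0
  obtain ⟨rfl, rfl, -⟩ := h0
  simpa using heq'

theorem card_eq_iff_decomposition_general (g : ℕ) [NeZero g]
    (a b : ℕ) (ha : 0 < a) (hb : 0 < b) (hab : Nat.Coprime a b)
    (U : Finset (ZMod g)) (h0 : (0 : ZMod g) ∈ U)
    (hgen : ∀ H : AddSubgroup (ZMod g), (↑U : Set (ZMod g)) ⊆ (H : Set (ZMod g)) → H = ⊤) :
    (Finset.image₂ (fun x y => (a : ZMod g) * x + (b : ZMod g) * y) U U).card = U.card ↔
      ∃ a₁ b₁ : ℕ, a₁ ∣ Nat.gcd g a ∧ b₁ ∣ Nat.gcd g b ∧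
        ∃ V X : Finset (ZMod g),
          (∀ v ∈ V, ∃ w : ZMod g, v = (a₁ : ZMod g) * w) ∧
          (∀ x ∈ X, ∃ w : ZMod g, x = (b₁ : ZMod g) * w) ∧
          U = Finset.image₂ (fun v x => v + x) V
                (Finset.image₂ (fun x h => x + h) X
                  (Finset.image (fun w : ZMod g => ((a₁ * b₁ : ℕ) : ZMod g) * w) Finset.univ)) ∧
          U.card = V.card * X.card *
            (Finset.image (fun w : ZMod g => ((a₁ * b₁ : ℕ) : ZMod g) * w) Finset.univ).card := by
  obtain ⟨α, β, hαβ⟩ := Nat.isCoprime_iff_coprime.2 hab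
  have hR : (α : ZMod g) * (a : ZMod g) + (β : ZMod g) * (b : ZMod g) = 1 := by
    exact_mod_cast congrArg (fun z : ℤ => (z : ZMod g)) hαβ
  constructor
  · intro hcard
    rw [dilateSum_natCast] at hcard
    have hstab := (card_le_card_dilateSum hαβ U).2 hcard
    have hprod : ∀ x ∈ U, ∀ y ∈ U, ((α : ZMod g) * a) * x + ((β : ZMod g) * b) * y ∈ U := by
      intro x hx y hy
      simpa [mul_assoc] using bezout_combination_mem hαβ hcard hstab hx hy
    have htop : (translationStabilizer U).comap (zsmulAddGroupHom ((a : ℤ) * b)) = ⊤ :=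
      hgen _ fun x hx => by simpa using hstab x hx 0 h0
    have hinv : ∀ x ∈ U, ∀ w : ZMod g, x + (a : ZMod g) * b * w ∈ U := by
      intro x hx w
      have hw : w ∈ (translationStabilizer U).comap (zsmulAddGroupHom ((a : ℤ) * b)) := by
        rw [htop]
        trivial
      have hw' : ((a : ℤ) * b) • w ∈ translationStabilizer U := hw
      simpa using hw' x hx
    obtain ⟨s, hs⟩ := exists_intCast_gcd_eq g a
    obtain ⟨t, ht⟩ := exists_intCast_gcd_eq g b
    obtain ⟨s', hs'⟩ := exists_natCast_eq_mul_of_dvd (R := ZMod g) (Nat.gcd_dvd_right g a)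
    obtain ⟨t', ht'⟩ := exists_natCast_eq_mul_of_dvd (R := ZMod g) (Nat.gcd_dvd_right g b)
    refine ⟨Nat.gcd g a, Nat.gcd g b, dvd_rfl, dvd_rfl, ?_⟩
    obtain ⟨V, X, hV, hX, hU, hc⟩ := exists_direct_decomposition
      (c := ((Nat.gcd g a * Nat.gcd g b : ℕ) : ZMod g)) hR
      ⟨α * β * s' * t', by
        push_cast
        linear_combination (α * β * b : ZMod g) * hs' +
          (α * β * (Nat.gcd g a : ZMod g) * s' : ZMod g) * ht'⟩ U
      (fun x hx w => by
        have := hinv x hx (s * t * w)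
        convert this using 2
        push_cast
        rw [hs, ht]
        ring) hprod
    refine ⟨V, X, fun v hv => ?_, fun x hx => ?_, hU, hc⟩
    · obtain ⟨x, w, rfl⟩ := hV v hv
      refine ⟨α * s' * x + (Nat.gcd g b : ZMod g) * w, ?_⟩
      push_cast
      linear_combination (α * x : ZMod g) * hs'
    · obtain ⟨y, w, rfl⟩ := hX x hx
      refine ⟨β * t' * y + (Nat.gcd g a : ZMod g) * w, ?_⟩
      push_cast
      linear_combination (β * y : ZMod g) * ht'
  · rintro ⟨a₁, b₁, ha₁, hb₁, V, X, hV, hX, hU, hc⟩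
    rw [Nat.cast_mul] at hU hc
    exact card_image₂_eq_of_direct_decomposition hR
      (exists_natCast_eq_mul_of_dvd (ha₁.trans (Nat.gcd_dvd_right g a)))
      (exists_natCast_eq_mul_of_dvd (hb₁.trans (Nat.gcd_dvd_right g b))) hV hX hU hc
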